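/- Let K ⊂ ℝⁿ be a compact set with |K| > 0, with 0 in the interior of the convex hull of K, and whose barycenter bar(K) = (1/|K|)∫_K x dx equals 0. Then |K|·|K°| ≤ |B₂ⁿ|². -/

import Mathlib

open MeasureTheory Set
open scoped RealInnerProductSpace ENNReal

/-- The polar of a set `A ⊆ ℝⁿ`: `A° = {y : ⟨x,y⟩ ≤ 1 for all x ∈ A}`. -/
def polarSet {n : ℕ} (A : Set (EuclideanSpace ℝ (Fin n))) : Set (EuclideanSpace ℝ (Fin n)) :=
  {y | ∀ x ∈ A, ⟪x, y⟫ ≤ 1}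

section
open scoped Pointwise

/-- One-dimensional Brunn-Minkowski inequality, for midpoints. -/
theorem volume_add_volume_le_of_midpoint_subset {A B C : Set ℝ} (hA : MeasurableSet A)
    (hB : MeasurableSet B) (hA0 : A.Nonempty) (hB0 : B.Nonempty)
    (h : ∀ a ∈ A, ∀ b ∈ B, (a + b) / 2 ∈ C) : volume A + volume B ≤ 2 * volume C := by
  obtain ⟨a₀, ha₀⟩ := hA0
  obtain ⟨b₀, hb₀⟩ := hB0
  have key : ∀ K ⊆ A, IsCompact K → ∀ L ⊆ B, IsCompact L → volume K + volume L ≤ 2 * volume C := by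
    intro K hK hKc L hL hLc
    have hK' : insert a₀ K ⊆ A := insert_subset ha₀ hK
    have hL' : insert b₀ L ⊆ B := insert_subset hb₀ hL
    obtain ⟨a, haK, ha⟩ := (hKc.insert a₀).exists_isGreatest (insert_nonempty _ _)
    obtain ⟨b, hbL, hb⟩ := (hLc.insert b₀).exists_isLeast (insert_nonempty _ _)
    have hsub : ((fun x => x + b) '' K) ∪ ((fun x => a + x) '' L) ⊆ (2 : ℝ) • C := by
      rintro _ (⟨x, hx, rfl⟩ | ⟨x, hx, rfl⟩)
      · exact ⟨_, h x (hK hx) b (hL' hbL), by simp; ring⟩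
      · exact ⟨_, h a (hK' haK) x (hL hx), by simp; ring⟩
    have hm : volume (((fun x => x + b) '' K) ∪ ((fun x => a + x) '' L))
        = volume K + volume L := by
      rw [measure_union₀]
      · congr 1
        · rw [image_add_right, measure_preimage_add_right]
        · rw [image_add_left, measure_preimage_add]
      · exact ((hLc.image (by fun_prop)).measurableSet).nullMeasurableSet
      · refine measure_mono_null (t := {a + b}) ?_ (by simp)
        rintro _ ⟨⟨x, hx, rfl⟩, ⟨y, hy, hxy⟩⟩
        have h1 := ha (mem_insert_of_mem _ hx)
        have h2 := hb (mem_insert_of_mem _ hy)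
        simp only [mem_singleton_iff] at hxy ⊢
        linarith
    calc _ = _ := hm.symm
      _ ≤ _ := measure_mono hsub
      _ = _ := by rw [Measure.addHaar_smul]; simp
  have hsup : ∀ D : Set ℝ, MeasurableSet D →
      volume D = ⨆ K : {K : Set ℝ // K ⊆ D ∧ IsCompact K}, volume K.1 := fun D hD => by
    rw [hD.measure_eq_iSup_isCompact, iSup_subtype]
    simp only [iSup_and]
  have hne : ∀ D : Set ℝ, Nonempty {K : Set ℝ // K ⊆ D ∧ IsCompact K} := fun D =>
    ⟨∅, empty_subset _, isCompact_empty⟩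
  rw [hsup A hA, hsup B hB]
  exact ENNReal.iSup_add_iSup_le fun K L => key K.1 K.2.1 K.2.2 L.1 L.2.1 L.2.2

end

theorem ENNReal.mul_le_sq_of_add_le {X Y Z : ℝ≥0∞} (h : X + Y ≤ 2 * Z) : X * Y ≤ Z ^ 2 := by
  rcases eq_or_ne Z ⊤ with hZ | hZ
  · simp [hZ]
  obtain ⟨hX, hY⟩ := ENNReal.add_ne_top.1 (h.trans_lt (ENNReal.mul_lt_top (by simp) hZ.lt_top)).ne
  lift X to NNReal using hX
  lift Y to NNReal using hY
  lift Z to NNReal using hZ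
  norm_cast at h ⊢
  have h1 : (X : ℝ) + Y ≤ 2 * Z := by exact_mod_cast h
  have h2 : (X : ℝ) * Y ≤ Z ^ 2 := by
    nlinarith [sq_nonneg ((X : ℝ) - Y), X.coe_nonneg, Y.coe_nonneg, Z.coe_nonneg]
  exact_mod_cast h2

/-- Prékopa-Leindler in dimension one for normalised functions. -/
theorem lintegral_add_le_of_midpoint {f g h : ℝ → ℝ} (hf : Measurable f) (hg : Measurable g)
    (hh : Measurable h) (hf0 : ∀ x, 0 ≤ f x) (hg0 : ∀ x, 0 ≤ g x) (hh0 : ∀ x, 0 ≤ h x)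
    (hf1 : ∀ x, f x ≤ 1) (hg1 : ∀ x, g x ≤ 1)
    (hfs : ∀ t < 1, ∃ x, t < f x) (hgs : ∀ t < 1, ∃ x, t < g x)
    (hfg : ∀ a b, f a * g b ≤ h ((a + b) / 2) ^ 2) :
    (∫⁻ x, ENNReal.ofReal (f x)) + ∫⁻ x, ENNReal.ofReal (g x) ≤ 2 * ∫⁻ x, ENNReal.ofReal (h x) := by
  rw [lintegral_eq_lintegral_meas_lt volume (.of_forall hf0) hf.aemeasurable,
    lintegral_eq_lintegral_meas_lt volume (.of_forall hg0) hg.aemeasurable,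
    lintegral_eq_lintegral_meas_lt volume (.of_forall hh0) hh.aemeasurable]
  have hm : ∀ u : ℝ → ℝ, Measurable (fun t => volume {a | t < u a}) := fun u =>
    Antitone.measurable fun s t hst => measure_mono fun x hx => lt_of_le_of_lt hst hx
  rw [← lintegral_add_left (hm f), ← lintegral_const_mul _ (hm h)]
  refine setLIntegral_mono ((hm h).const_mul _) fun t ht => ?_
  have ht0 : 0 < t := ht
  rcases lt_or_ge t 1 with ht1 | ht1
  · refine volume_add_volume_le_of_midpoint_subset (measurableSet_lt measurable_const hf)
      (measurableSet_lt measurable_const hg) (hfs t ht1) (hgs t ht1) fun a ha b hb => ?_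
    have ha' : t < f a := ha
    have hb' : t < g b := hb
    refine lt_of_pow_lt_pow_left₀ 2 (hh0 _) (lt_of_lt_of_le ?_ (hfg a b))
    nlinarith
  · have : ∀ u : ℝ → ℝ, (∀ x, u x ≤ 1) → {a | t < u a} = ∅ := fun u hu => by
      ext x; simpa using (hu x).trans ht1
    simp [this f hf1, this g hg1]

/-- Prékopa-Leindler in dimension one. -/
theorem lintegral_mul_lintegral_le_of_midpoint {f g : ℝ → ℝ≥0∞} {h : ℝ → ℝ} (hf : Measurable f)
    (hg : Measurable g) (hh : Measurable h) (hh0 : ∀ x, 0 ≤ h x) {M : ℝ} (hM : ∀ x, h x ≤ M)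
    (hfg : ∀ a b, f a * g b ≤ ENNReal.ofReal (h ((a + b) / 2) ^ 2)) :
    (∫⁻ x, f x) * ∫⁻ x, g x ≤ (∫⁻ x, ENNReal.ofReal (h x)) ^ 2 := by
  set S := ⨆ x, f x with hS
  set T := ⨆ x, g x with hT
  have hST : S * T ≤ ENNReal.ofReal (M ^ 2) := by
    simp only [hS, hT, ENNReal.iSup_mul, ENNReal.mul_iSup, iSup_le_iff]
    intro a b
    exact (hfg _ _).trans (ENNReal.ofReal_le_ofReal (pow_le_pow_left₀ (hh0 _) (hM _) 2))
  rcases eq_or_ne S 0 with hS0 | hS0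
  · have : ∀ x, f x = 0 := by simpa [hS] using hS0
    simp [this]
  rcases eq_or_ne T 0 with hT0 | hT0
  · have : ∀ x, g x = 0 := by simpa [hT] using hT0
    simp [this]
  have hSTf : S * T ≠ ⊤ := (hST.trans_lt ENNReal.ofReal_lt_top).ne
  have hSf : S ≠ ⊤ := fun h => hSTf (by simp [h, hT0])
  have hTf : T ≠ ⊤ := fun h => hSTf (by simp [h, hS0])
  set s := S.toReal with hs
  set t := T.toReal with ht
  have hs0 : 0 < s := ENNReal.toReal_pos hS0 hSf
  have ht0 : 0 < t := ENNReal.toReal_pos hT0 hTf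
  have norm_aux : ∀ u : ℝ → ℝ≥0∞, Measurable u → (⨆ x, u x) ≠ 0 → (⨆ x, u x) ≠ ⊤ →
      Measurable (fun x => (u x).toReal / (⨆ x, u x).toReal) ∧
      (∀ x, 0 ≤ (u x).toReal / (⨆ x, u x).toReal) ∧
      (∀ x, (u x).toReal / (⨆ x, u x).toReal ≤ 1) ∧
      (∀ r < 1, ∃ x, r < (u x).toReal / (⨆ x, u x).toReal) ∧
      ∫⁻ x, u x = (⨆ x, u x) * ∫⁻ x, ENNReal.ofReal ((u x).toReal / (⨆ x, u x).toReal) := by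
    intro u hu h0 hf
    have hp := ENNReal.toReal_pos h0 hf
    have hux : ∀ x, u x ≠ ⊤ := fun x => ((le_iSup u x).trans_lt hf.lt_top).ne
    refine ⟨by fun_prop, fun x => by positivity, fun x => ?_, fun r hr => ?_, ?_⟩
    · rw [div_le_one hp]
      exact ENNReal.toReal_mono hf (le_iSup u x)
    · by_contra! hcon
      have : (⨆ x, u x) ≤ ENNReal.ofReal (r * (⨆ x, u x).toReal) := by
        refine iSup_le fun x => ?_
        rw [← ENNReal.ofReal_toReal (hux x)]
        apply ENNReal.ofReal_le_ofReal
        have := hcon x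
        rwa [div_le_iff₀ hp] at this
      have h2 : (⨆ x, u x).toReal ≤ (ENNReal.ofReal (r * (⨆ x, u x).toReal)).toReal :=
        ENNReal.toReal_mono (by simp) this
      have hr0 : 0 ≤ r := le_trans (by positivity) (hcon 0)
      rw [ENNReal.toReal_ofReal (by positivity)] at h2
      nlinarith
    · rw [← lintegral_const_mul _ (by fun_prop)]
      refine lintegral_congr fun x => ?_
      rw [ENNReal.ofReal_div_of_pos hp, ENNReal.ofReal_toReal hf, ENNReal.ofReal_toReal (hux x),
        ENNReal.mul_div_cancel h0 hf]
  obtain ⟨f1, f2, f3, f4, f5⟩ := norm_aux f hf hS0 hSf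
  obtain ⟨g1, g2, g3, g4, g5⟩ := norm_aux g hg hT0 hTf
  have hst : 0 < Real.sqrt (s * t) := Real.sqrt_pos.2 (by positivity)
  have := lintegral_add_le_of_midpoint (h := fun x => h x / Real.sqrt (s * t)) f1 g1 (by fun_prop)
    f2 g2 (fun x => div_nonneg (hh0 _) hst.le) f3 g3 f4 g4 (by
      intro a b
      rw [div_pow, Real.sq_sqrt (by positivity), div_mul_div_comm]
      gcongr
      rw [← ENNReal.toReal_mul]
      exact ENNReal.toReal_le_of_le_ofReal (by positivity) (hfg a b))
  rw [f5, g5]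
  set X := ∫⁻ x, ENNReal.ofReal ((f x).toReal / (⨆ x, f x).toReal)
  set Y := ∫⁻ x, ENNReal.ofReal ((g x).toReal / (⨆ x, g x).toReal)
  have hZ : ∫⁻ x, ENNReal.ofReal (h x / Real.sqrt (s * t))
      = ENNReal.ofReal (Real.sqrt (s * t))⁻¹ * ∫⁻ x, ENNReal.ofReal (h x) := by
    rw [← lintegral_const_mul _ (by fun_prop)]
    refine lintegral_congr fun x => ?_
    rw [← ENNReal.ofReal_mul (by positivity), div_eq_inv_mul]
  rw [hZ] at this
  set I := ∫⁻ x, ENNReal.ofReal (h x)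
  have hXY : X * Y ≤ (ENNReal.ofReal (Real.sqrt (s * t))⁻¹ * I) ^ 2 :=
    ENNReal.mul_le_sq_of_add_le this
  calc S * X * (T * Y) = (S * T) * (X * Y) := by ring
    _ ≤ (S * T) * (ENNReal.ofReal (Real.sqrt (s * t))⁻¹ * I) ^ 2 := by gcongr
    _ = I ^ 2 := by
      rw [mul_pow, ← mul_assoc, ← ENNReal.ofReal_toReal hSf, ← ENNReal.ofReal_toReal hTf,
        ← ENNReal.ofReal_pow (by positivity), ← ENNReal.ofReal_mul (by positivity),
        ← ENNReal.ofReal_mul (by positivity), inv_pow, Real.sq_sqrt (by positivity),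
        mul_inv_cancel₀ (by positivity)]
      simp

theorem lintegral_Ioi_eq_lintegral_exp (φ : ℝ → ℝ≥0∞) :
    ∫⁻ s in Ioi 0, φ s = ∫⁻ a, ENNReal.ofReal (Real.exp a) * φ (Real.exp a) := by
  have h := lintegral_image_eq_lintegral_abs_deriv_mul MeasurableSet.univ
    (fun x _ => (Real.hasDerivAt_exp x).hasDerivWithinAt) Real.exp_injective.injOn φ
  rw [image_univ, Real.range_exp] at h
  simpa using h

theorem lintegral_exp_neg_sq_Ioi :
    ∫⁻ s in Ioi (0 : ℝ), ENNReal.ofReal (Real.exp (-(1 / 2) * s ^ 2))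
      = ENNReal.ofReal (Real.sqrt (Real.pi / 2)) := by
  rw [← ofReal_integral_eq_lintegral_ofReal (integrable_exp_neg_mul_sq (by norm_num)).integrableOn
    (.of_forall fun x => by positivity), integral_gaussian_Ioi]
  congr 1
  rw [div_eq_iff (by norm_num), show Real.pi / (1 / 2) = Real.pi / 2 * 2 ^ 2 by ring,
    Real.sqrt_mul (by positivity), Real.sqrt_sq (by norm_num)]

/-- The one-dimensional half-line case of the functional Santaló inequality. -/
theorem lintegral_Ioi_mul_lintegral_Ioi_le {φ ψ : ℝ → ℝ≥0∞} (hφ : Measurable φ)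
    (hψ : Measurable ψ) (α : ℝ)
    (h : ∀ s > 0, ∀ t > 0, φ s * ψ t ≤ ENNReal.ofReal (Real.exp (-(α + s * t)))) :
    (∫⁻ s in Ioi 0, φ s) * ∫⁻ t in Ioi 0, ψ t
      ≤ ENNReal.ofReal (Real.pi / 2) * ENNReal.ofReal (Real.exp (-α)) := by
  rw [lintegral_Ioi_eq_lintegral_exp, lintegral_Ioi_eq_lintegral_exp]
  set k : ℝ → ℝ := fun r =>
    Real.exp (-α / 2) * (Real.exp r * Real.exp (-(1 / 2) * (Real.exp r) ^ 2)) with hk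
  have hk0 : ∀ r, 0 ≤ k r := fun r => by positivity
  refine (lintegral_mul_lintegral_le_of_midpoint (h := k) (M := Real.exp (-α / 2) * 1)
    (by fun_prop) (by fun_prop) (by fun_prop) hk0 (fun r => ?_) fun a b => ?_).trans_eq ?_
  · simp only [hk]
    gcongr
    rw [← Real.exp_add, Real.exp_le_one_iff]
    nlinarith [Real.add_one_le_exp r, sq_nonneg (Real.exp r - 1)]
  · calc _ = ENNReal.ofReal (Real.exp a) * ENNReal.ofReal (Real.exp b)
          * (φ (Real.exp a) * ψ (Real.exp b)) := by ring
      _ ≤ ENNReal.ofReal (Real.exp a) * ENNReal.ofReal (Real.exp b)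
          * ENNReal.ofReal (Real.exp (-(α + Real.exp a * Real.exp b))) := by
        gcongr
        exact h _ (Real.exp_pos a) _ (Real.exp_pos b)
      _ = _ := by
        rw [← ENNReal.ofReal_mul (by positivity), ← ENNReal.ofReal_mul (by positivity)]
        congr 1
        simp only [hk, ← Real.exp_add, ← Real.exp_nat_mul]
        congr 1
        push_cast
        rw [mul_div_cancel₀ (a + b) two_ne_zero]
        ring
  · have h1 : ∫⁻ r, ENNReal.ofReal (k r)
        = ENNReal.ofReal (Real.exp (-α / 2)) * ENNReal.ofReal (Real.sqrt (Real.pi / 2)) := by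
      rw [← lintegral_exp_neg_sq_Ioi, lintegral_Ioi_eq_lintegral_exp,
        ← lintegral_const_mul _ (by fun_prop)]
      refine lintegral_congr fun r => ?_
      rw [← ENNReal.ofReal_mul (by positivity), ← ENNReal.ofReal_mul (by positivity)]
    rw [h1, mul_pow, ← ENNReal.ofReal_pow (by positivity), ← ENNReal.ofReal_pow (by positivity),
      Real.sq_sqrt (by positivity), ← Real.exp_nat_mul, mul_comm]
    congr 3
    push_cast
    ring

/-- The functional Santaló inequality on `ℝⁿ` for densities with barycenter at the origin. -/
def CenteredSantalo (n : ℕ) : Prop :=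
  ∀ (f : (Fin n → ℝ) → ℝ) (g : (Fin n → ℝ) → ℝ≥0∞), Measurable f → (∀ x, 0 ≤ f x) →
    Integrable f → Integrable (fun x => f x • x) → ∫ x, f x • x = 0 → Measurable g →
    (∀ x y, ENNReal.ofReal (f x) * g y ≤ ENNReal.ofReal (Real.exp (-(x ⬝ᵥ y)))) →
    ENNReal.ofReal (∫ x, f x) * ∫⁻ y, g y ≤ ENNReal.ofReal (2 * Real.pi) ^ n

theorem MeasureTheory.MeasurePreserving.integral_comp_of_integrable {α β E : Type*}
    [MeasurableSpace α] [MeasurableSpace β] [NormedAddCommGroup E] [NormedSpace ℝ E]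
    {μ : Measure α} {ν : Measure β} {T : α → β} (hT : MeasurePreserving T μ ν) {u : β → E}
    (hu : Integrable u ν) : ∫ x, u (T x) ∂μ = ∫ y, u y ∂ν := by
  rw [← hT.map_eq, integral_map hT.measurable.aemeasurable]
  rw [hT.map_eq]
  exact hu.aestronglyMeasurable

/-- If `n`-dimensional centered functional Santaló holds, it bounds the integrals of a pair of
functions over a half-space of `ℝ × ℝⁿ`, sheared along the direction `(1, w)`. -/
theorem CenteredSantalo.halfSpace {n : ℕ} (hC : CenteredSantalo n)
    {φ : ℝ × (Fin n → ℝ) → ℝ} {γ : ℝ × (Fin n → ℝ) → ℝ≥0∞} (hφ : Measurable φ)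
    (hφ0 : ∀ p, 0 ≤ φ p) (hγ : Measurable γ)
    (hi : Integrable φ ((volume.restrict (Ioi 0)).prod volume))
    (hi1 : Integrable (fun p => φ p * p.1) ((volume.restrict (Ioi 0)).prod volume))
    (hi2 : Integrable (fun p => φ p • p.2) ((volume.restrict (Ioi 0)).prod volume))
    (w z : Fin n → ℝ)
    (hwz : ∫ p, φ p • p.2 ∂((volume.restrict (Ioi 0)).prod volume)
      - (∫ p, φ p * p.1 ∂((volume.restrict (Ioi 0)).prod volume)) • w
      = (∫ p, φ p ∂((volume.restrict (Ioi 0)).prod volume)) • z)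
    (h : ∀ s x t y, ENNReal.ofReal (φ (s, z + x)) * γ (t, y)
      ≤ ENNReal.ofReal (Real.exp (-(s * t + x ⬝ᵥ y)))) :
    ENNReal.ofReal (∫ p, φ p ∂((volume.restrict (Ioi 0)).prod volume))
      * ∫⁻ y, ∫⁻ t in Ioi 0, γ (t - w ⬝ᵥ y, y)
      ≤ ENNReal.ofReal (Real.pi / 2) * ENNReal.ofReal (2 * Real.pi) ^ n := by
  set ν : Measure ℝ := volume.restrict (Ioi 0) with hν
  set T : ℝ × (Fin n → ℝ) → ℝ × (Fin n → ℝ) := fun p => (p.1, z + p.2 + p.1 • w) with hT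
  have hTm : Measurable T := by fun_prop
  have hTp : MeasurePreserving T (ν.prod volume) (ν.prod volume) := by
    refine (MeasurePreserving.id ν).skew_product (g := fun s x => z + x + s • w) (by fun_prop) ?_
    refine .of_forall fun s => ?_
    simp only [add_comm z, add_assoc]
    exact map_add_right_eq_self volume _
  have hI1 : Integrable (φ ∘ T) (ν.prod volume) := hTp.integrable_comp_of_integrable hi
  have hI2' : Integrable (fun p : ℝ × (Fin n → ℝ) => φ p • (p.2 - z - p.1 • w)) (ν.prod volume) := by
    simp only [smul_sub, smul_smul]
    exact (hi2.sub (hi.smul_const z)).sub (hi1.smul_const w)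
  have hI2 : Integrable (fun p : ℝ × (Fin n → ℝ) => φ (T p) • p.2) (ν.prod volume) := by
    refine (hTp.integrable_comp_of_integrable hI2').congr (.of_forall fun p => ?_)
    simp only [hT, Function.comp_apply]
    congr 1
    abel
  set F : (Fin n → ℝ) → ℝ := fun x => ∫ s, φ (T (s, x)) ∂ν with hF
  set G : (Fin n → ℝ) → ℝ≥0∞ := fun y => ∫⁻ t in Ioi 0, γ (t - w ⬝ᵥ y, y) with hG
  have hshear : Measurable fun p : (Fin n → ℝ) × ℝ => (p.2 - w ⬝ᵥ p.1, p.1) := by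
    simp only [dotProduct]; fun_prop
  have hGm : Measurable G := by
    exact (hγ.comp hshear).lintegral_prod_right'
  have hFm : Measurable F := by
    exact ((hφ.comp hTm).stronglyMeasurable.integral_prod_left').measurable
  have hFint : Integrable F := hI1.integral_prod_right
  have hFeq : ∫ x, F x = ∫ p, φ p ∂(ν.prod volume) := by
    rw [← hTp.integral_comp_of_integrable hi]
    exact (integral_prod_symm _ hI1).symm
  have hF1 : ∀ x, F x • x = ∫ s, φ (T (s, x)) • x ∂ν := fun x => (integral_smul_const _ _).symm
  have hFmom : Integrable (fun x => F x • x) := by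
    simp only [hF1]
    exact hI2.integral_prod_right
  have hFbar : ∫ x, F x • x = 0 := by
    simp only [hF1]
    rw [← integral_prod_symm _ hI2]
    have : ∀ p : ℝ × (Fin n → ℝ), φ (T p) • p.2
        = (fun p : ℝ × (Fin n → ℝ) => φ p • (p.2 - z - p.1 • w)) (T p) := fun p => by
      simp only [hT]
      congr 1
      abel
    rw [integral_congr_ae (.of_forall this), hTp.integral_comp_of_integrable hI2']
    simp only [smul_sub, smul_smul]
    have hi3 : Integrable (fun p : ℝ × (Fin n → ℝ) => φ p • p.2 - φ p • z) (ν.prod volume) :=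
      hi2.sub (hi.smul_const z)
    rw [integral_sub hi3 (hi1.smul_const w), integral_sub hi2
      (hi.smul_const z), integral_smul_const, integral_smul_const, ← hwz]
    abel
  have hc0 : ENNReal.ofReal (Real.pi / 2) ≠ 0 := by
    simpa using Real.pi_pos
  have key := hC F (fun y => (ENNReal.ofReal (Real.pi / 2))⁻¹ * G y) hFm
    (fun x => integral_nonneg fun s => hφ0 _) hFint hFmom hFbar (hGm.const_mul _) fun x y => by
      rw [mul_left_comm, ENNReal.inv_mul_le_iff hc0 ENNReal.ofReal_ne_top]
      have hle : ENNReal.ofReal (F x) ≤ ∫⁻ s in Ioi 0, ENNReal.ofReal (φ (T (s, x))) := by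
        by_cases hInt : Integrable (fun s => φ (T (s, x))) ν
        · exact (ofReal_integral_eq_lintegral_ofReal hInt (.of_forall fun s => hφ0 _)).le
        · simp [hF, integral_undef hInt]
      refine (mul_le_mul_left hle _).trans (lintegral_Ioi_mul_lintegral_Ioi_le
        (ψ := fun t => γ (t - w ⬝ᵥ y, y)) (by fun_prop) (by fun_prop) _ fun s _ t _ => ?_)
      have := h s (x + s • w) (t - w ⬝ᵥ y) y
      simp only [hT, add_assoc] at this ⊢
      convert this using 4
      rw [add_dotProduct, smul_dotProduct, smul_eq_mul]
      ring
  rw [hFeq, lintegral_const_mul _ hGm, mul_left_comm,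
    ENNReal.inv_mul_le_iff hc0 ENNReal.ofReal_ne_top] at key
  exact key

theorem exists_setIntegral_Iic_eq_Ioi {ρ : ℝ → ℝ} (hρ : Integrable ρ) (hpos : 0 < ∫ x, ρ x) :
    ∃ c, ∫ x in Iic c, ρ x = ∫ x in Ioi c, ρ x := by
  have hsplit : ∀ c, (∫ x in Iic c, ρ x) + ∫ x in Ioi c, ρ x = ∫ x, ρ x := fun c => by
    rw [← compl_Iic]
    exact integral_add_compl measurableSet_Iic hρ
  have hcont : Continuous fun c => ∫ x in Iic c, ρ x := by
    have : ∀ c, ∫ x in Iic c, ρ x = (∫ x in Iic 0, ρ x) + ∫ x in (0 : ℝ)..c, ρ x := fun c => by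
      rw [← intervalIntegral.integral_Iic_sub_Iic hρ.integrableOn hρ.integrableOn]
      ring
    rw [funext this]
    exact continuous_const.add (hρ.continuous_primitive 0)
  have htop : Filter.Tendsto (fun c => ∫ x in Iic c, ρ x) Filter.atTop (nhds (∫ x, ρ x)) :=
    (aecover_Iic Filter.tendsto_id).integral_tendsto_of_countably_generated hρ
  have hbot : Filter.Tendsto (fun c => ∫ x in Ioi c, ρ x) Filter.atBot (nhds (∫ x, ρ x)) :=
    (aecover_Ioi Filter.tendsto_id).integral_tendsto_of_countably_generated hρ
  obtain ⟨a, ha⟩ := (htop.eventually (lt_mem_nhds (half_lt_self hpos))).exists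
  obtain ⟨b, hb⟩ := (hbot.eventually (lt_mem_nhds (half_lt_self hpos))).exists
  have hb' : ∫ x in Iic b, ρ x ≤ (∫ x, ρ x) / 2 := by linarith [hsplit b]
  obtain ⟨c, hc⟩ := mem_range_of_exists_le_of_exists_ge hcont ⟨b, hb'⟩ ⟨a, ha.le⟩
  exact ⟨c, by linarith [hsplit c]⟩

/-- The inductive step: a density on `ℝ × ℝⁿ` satisfies the functional Santaló inequality with
respect to some centre. -/
theorem CenteredSantalo.exists_center_prod {n : ℕ} (hC : CenteredSantalo n)
    {f : ℝ × (Fin n → ℝ) → ℝ} (hf : Measurable f) (hf0 : ∀ p, 0 ≤ f p) (hi : Integrable f)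
    (hi1 : Integrable fun p => f p * p.1) (hi2 : Integrable fun p => f p • p.2) :
    ∃ (c : ℝ) (z : Fin n → ℝ), ∀ g : ℝ × (Fin n → ℝ) → ℝ≥0∞, Measurable g →
      (∀ s x t y, ENNReal.ofReal (f (c + s, z + x)) * g (t, y)
        ≤ ENNReal.ofReal (Real.exp (-(s * t + x ⬝ᵥ y)))) →
      ENNReal.ofReal (∫ p, f p) * ∫⁻ p, g p ≤ ENNReal.ofReal (2 * Real.pi) ^ (n + 1) := by
  rcases (show 0 ≤ ∫ p, f p from integral_nonneg hf0).eq_or_lt with hI | hI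
  · exact ⟨0, 0, fun g _ _ => by simp [← hI]⟩
  rw [Measure.volume_eq_prod] at hi hi1 hi2 hI ⊢
  set N : Measure (ℝ × (Fin n → ℝ)) := (volume.restrict (Ioi 0)).prod volume with hN
  have hNe : N = ((volume : Measure ℝ).prod volume).restrict (Ioi 0 ×ˢ univ) := by
    rw [← Measure.prod_restrict, Measure.restrict_univ]
  obtain ⟨c, hc⟩ := exists_setIntegral_Iic_eq_Ioi hi.integral_prod_left
    (by rwa [← integral_prod _ hi])
  set σ : ℝ → ℝ × (Fin n → ℝ) → ℝ × (Fin n → ℝ) := fun ε p => (c + ε * p.1, p.2) with hσ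
  have hσm : ∀ ε, Measurable (σ ε) := fun ε => by fun_prop
  have hσp : ∀ ε, ε = 1 ∨ ε = -1 →
      MeasurePreserving (σ ε) ((volume : Measure ℝ).prod volume) (volume.prod volume) := by
    intro ε hε
    have h1 : MeasurePreserving (fun s : ℝ => c + ε * s) volume volume := by
      rcases hε with rfl | rfl
      · simpa using measurePreserving_add_left volume c
      · simp only [neg_one_mul]
        exact (measurePreserving_add_left volume c).comp
          (Measure.measurePreserving_neg (volume : Measure ℝ))
    exact h1.prod (MeasurePreserving.id volume)
  have hJ : ∀ ε, ε = 1 ∨ ε = -1 → Integrable (fun p => f (σ ε p)) N := fun ε hε => by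
    rw [hNe]
    exact ((hσp ε hε).integrable_comp_of_integrable hi).integrableOn
  have hJ1 : ∀ ε, ε = 1 ∨ ε = -1 → Integrable (fun p => f (σ ε p) * p.1) N := fun ε hε => by
    have h1 : Integrable (fun p => f (σ ε p) * (c + ε * p.1)) N := by
      rw [hNe]
      exact ((hσp ε hε).integrable_comp_of_integrable hi1).integrableOn
    refine ((h1.sub ((hJ ε hε).mul_const c)).mul_const ε).congr (.of_forall fun p => ?_)
    have : ε * ε = 1 := by rcases hε with rfl | rfl <;> norm_num
    simp only [Pi.sub_apply]
    linear_combination (f (σ ε p) * p.1) * this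
  have hJ2 : ∀ ε, ε = 1 ∨ ε = -1 → Integrable (fun p => f (σ ε p) • p.2) N := fun ε hε => by
    rw [hNe]
    exact ((hσp ε hε).integrable_comp_of_integrable hi2).integrableOn
  set m : ℝ → ℝ := fun ε => ∫ p, f (σ ε p) ∂N with hm
  set q : ℝ → ℝ := fun ε => ∫ p, f (σ ε p) * p.1 ∂N with hq
  set P : ℝ → Fin n → ℝ := fun ε => ∫ p, f (σ ε p) • p.2 ∂N with hP
  have hm1 : m 1 = ∫ s in Ioi c, ∫ x, f (s, x) := by
    simp only [hm, hN]
    rw [integral_prod _ (hJ 1 (.inl rfl))]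
    simp only [hσ, one_mul]
    have := (measurePreserving_add_left volume c).setIntegral_preimage_emb
      (measurableEmbedding_addLeft c) (fun s => ∫ x, f (s, x)) (Ioi c)
    simpa using this
  have hm2 : m (-1) = ∫ s in Iic c, ∫ x, f (s, x) := by
    simp only [hm, hN]
    rw [integral_prod _ (hJ (-1) (.inr rfl))]
    simp only [hσ, neg_one_mul]
    rw [integral_comp_neg_Ioi 0 (fun s => ∫ x, f (c + s, x))]
    have := (measurePreserving_add_left volume c).setIntegral_preimage_emb
      (measurableEmbedding_addLeft c) (fun s => ∫ x, f (s, x)) (Iic c)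
    simpa using this
  have hmm : m (-1) = m 1 := by rw [hm1, hm2, hc]
  have hmI : ∫ p, f p ∂((volume : Measure ℝ).prod volume) = m 1 + m 1 := by
    nth_rw 1 [← hmm]
    rw [hm1, hm2, integral_prod _ hi, ← compl_Iic]
    exact (integral_add_compl measurableSet_Iic hi.integral_prod_left).symm
  have hm0 : 0 < m 1 := by linarith
  have hNpos : ∀ᵐ p ∂N, 0 < p.1 := by
    rw [hNe]
    filter_upwards [ae_restrict_mem (measurableSet_Ioi.prod MeasurableSet.univ)] with p hp
    exact hp.1
  have hqpos : ∀ ε, ε = 1 ∨ ε = -1 → 0 < q ε := fun ε hε => by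
    have hnn : 0 ≤ᵐ[N] fun p => f (σ ε p) * p.1 := by
      filter_upwards [hNpos] with p hp using mul_nonneg (hf0 _) hp.le
    refine (integral_nonneg_of_ae hnn).lt_of_ne fun h0 => ?_
    have hz := (integral_eq_zero_iff_of_nonneg_ae hnn (hJ1 ε hε)).1 h0.symm
    have : m ε = 0 := by
      refine integral_eq_zero_of_ae ?_
      filter_upwards [hz, hNpos] with p h1 h2
      exact (mul_eq_zero.1 h1).resolve_right h2.ne'
    rcases hε with rfl | rfl <;> linarith
  have hqs : 0 < q 1 + q (-1) := add_pos (hqpos 1 (.inl rfl)) (hqpos (-1) (.inr rfl))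
  set w : Fin n → ℝ := (q 1 + q (-1))⁻¹ • (P 1 - P (-1)) with hw
  set z : Fin n → ℝ := (m 1)⁻¹ • (P 1 - q 1 • w) with hz
  have hwq : (q 1 + q (-1)) • w = P 1 - P (-1) := smul_inv_smul₀ hqs.ne' _
  have hz1 : m 1 • z = P 1 - q 1 • w := smul_inv_smul₀ hm0.ne' _
  refine ⟨c, z, fun g hg h => ?_⟩
  have key : ∀ ε, ε = 1 ∨ ε = -1 → P ε - q ε • (ε • w) = m ε • z →
      ENNReal.ofReal (m ε) * ∫⁻ y, ∫⁻ t in Ioi 0, g (ε * t - w ⬝ᵥ y, y)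
        ≤ ENNReal.ofReal (Real.pi / 2) * ENNReal.ofReal (2 * Real.pi) ^ n := by
    intro ε hε hεz
    have hεε : ε * ε = 1 := by rcases hε with rfl | rfl <;> norm_num
    have := hC.halfSpace (γ := fun p => g (ε * p.1, p.2)) (hf.comp (hσm ε)) (fun p => hf0 _)
      (by fun_prop) (hJ ε hε) (hJ1 ε hε) (hJ2 ε hε) (ε • w) z hεz fun s x t y => by
        refine (h (ε * s) x (ε * t) y).trans_eq ?_
        rw [show ε * s * (ε * t) = s * t by linear_combination (s * t) * hεε]
    simp only [smul_dotProduct, smul_eq_mul, mul_sub, ← mul_assoc, hεε, one_mul] at this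
    exact this
  have k1 := key 1 (.inl rfl) (by rw [one_smul, hz1])
  have k2 := key (-1) (.inr rfl) (by
    rw [hmm, hz1, neg_one_smul, smul_neg]
    rw [add_smul] at hwq
    rw [sub_neg_eq_add, eq_sub_iff_add_eq, add_assoc, add_comm (q (-1) • w), hwq]
    abel)
  have hshear : Measurable fun p : (Fin n → ℝ) × ℝ => (p.2 - w ⬝ᵥ p.1, p.1) := by
    simp only [dotProduct]; fun_prop
  have hgint : ∫⁻ p, g p ∂((volume : Measure ℝ).prod volume)
      = (∫⁻ y, ∫⁻ t in Ioi 0, g (1 * t - w ⬝ᵥ y, y))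
        + ∫⁻ y, ∫⁻ t in Ioi 0, g (-1 * t - w ⬝ᵥ y, y) := by
    rw [← lintegral_add_left, lintegral_prod_symm _ hg.aemeasurable]
    · refine lintegral_congr fun y => ?_
      have h1 := (measurePreserving_sub_right volume (w ⬝ᵥ y)).lintegral_comp_emb
        (measurableEmbedding_subRight (w ⬝ᵥ y)) (fun t => g (t, y))
      have h2 := (Measure.measurePreserving_neg (volume : Measure ℝ)).setLIntegral_comp_preimage_emb
        (MeasurableEquiv.neg ℝ).measurableEmbedding (fun t => g (t - w ⬝ᵥ y, y)) (Iio 0)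
      simp only [neg_preimage, neg_Iio, neg_zero] at h2
      simp only [one_mul, neg_one_mul]
      rw [h2, ← h1, ← setLIntegral_congr Iio_ae_eq_Iic.symm, ← compl_Iic, add_comm]
      exact (lintegral_add_compl _ measurableSet_Iic).symm
    · simp only [one_mul]
      exact (hg.comp hshear).lintegral_prod_right'
  rw [hmm] at k2
  rw [hmI, hgint, ENNReal.ofReal_add hm0.le hm0.le, ← two_mul, mul_assoc, mul_add]
  calc _ ≤ 2 * (ENNReal.ofReal (Real.pi / 2) * ENNReal.ofReal (2 * Real.pi) ^ n
      + ENNReal.ofReal (Real.pi / 2) * ENNReal.ofReal (2 * Real.pi) ^ n) := by gcongr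
    _ = (4 * ENNReal.ofReal (Real.pi / 2)) * ENNReal.ofReal (2 * Real.pi) ^ n := by ring
    _ = _ := by
      rw [pow_succ', show (4 : ℝ≥0∞) = ENNReal.ofReal 4 by simp, ← ENNReal.ofReal_mul (by norm_num)]
      congr 2
      ring

theorem CenteredSantalo.exists_center {n : ℕ} (hC : CenteredSantalo n)
    {f : (Fin (n + 1) → ℝ) → ℝ} (hf : Measurable f) (hf0 : ∀ x, 0 ≤ f x) (hi : Integrable f)
    (hi1 : Integrable fun x => f x • x) :
    ∃ z : Fin (n + 1) → ℝ, ∀ g : (Fin (n + 1) → ℝ) → ℝ≥0∞, Measurable g →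
      (∀ x y, ENNReal.ofReal (f (z + x)) * g y ≤ ENNReal.ofReal (Real.exp (-(x ⬝ᵥ y)))) →
      ENNReal.ofReal (∫ x, f x) * ∫⁻ y, g y ≤ ENNReal.ofReal (2 * Real.pi) ^ (n + 1) := by
  set e := (MeasurableEquiv.piFinSuccAbove (fun _ : Fin (n + 1) => ℝ) 0).symm with he
  have hep : MeasurePreserving e volume volume :=
    (volume_preserving_piFinSuccAbove (fun _ : Fin (n + 1) => ℝ) 0).symm
  have hecons : ∀ p, e p = Fin.cons p.1 p.2 := fun p => by
    simp [he, MeasurableEquiv.piFinSuccAbove, Fin.consEquiv]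
  have hfe : Measurable fun p => f (e p) := hf.comp e.measurable
  have hmom := (hep.integrable_comp_emb e.measurableEmbedding).2 hi1
  obtain ⟨c, z, hz⟩ := hC.exists_center_prod (f := fun p => f (e p)) hfe (fun p => hf0 _)
    ((hep.integrable_comp_emb e.measurableEmbedding).2 hi)
    (hmom.mono (hfe.mul measurable_fst).aestronglyMeasurable (.of_forall fun p => by
      simp only [Function.comp_apply, norm_smul, norm_mul]
      gcongr
      simpa [hecons] using norm_le_pi_norm (e p) 0))
    (hmom.mono (hfe.smul measurable_snd).aestronglyMeasurable (.of_forall fun p => by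
      simp only [Function.comp_apply, norm_smul]
      gcongr
      refine (pi_norm_le_iff_of_nonneg (norm_nonneg _)).2 fun i => ?_
      simpa [hecons] using norm_le_pi_norm (e p) i.succ))
  refine ⟨Fin.cons c z, fun g hg h => ?_⟩
  have key := hz (fun p => g (e p)) (hg.comp e.measurable) fun s x t y => by
    have := h (Fin.cons s x) (Fin.cons t y)
    have hadd : (Fin.cons c z + Fin.cons s x : Fin (n + 1) → ℝ) = Fin.cons (c + s) (z + x) := by
      ext i
      refine Fin.cases ?_ (fun i => ?_) i <;> simp
    rw [hadd] at this
    simp only [hecons]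
    refine this.trans_eq ?_
    simp [dotProduct, Fin.sum_univ_succ]
  rwa [hep.integral_comp e.measurableEmbedding, hep.lintegral_comp_emb e.measurableEmbedding] at key

theorem centeredSantalo_zero : CenteredSantalo 0 := by
  intro f g _ _ _ _ _ _ h
  rw [Measure.volume_pi_eq_dirac (default : Fin 0 → ℝ), integral_dirac, lintegral_dirac]
  simpa using h default default

theorem CenteredSantalo.succ {n : ℕ} (hC : CenteredSantalo n) : CenteredSantalo (n + 1) := by
  intro f g hf hf0 hi hi1 hbar hg h
  set B : ℕ → Set (Fin (n + 1) → ℝ) := fun N => Metric.closedBall 0 N with hB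
  set u : ℕ → (Fin (n + 1) → ℝ) → ℝ≥0∞ := fun N => (B N).indicator fun y => min (g y) N with hu
  have hum : ∀ N, Measurable (u N) := fun N =>
    (hg.min measurable_const).indicator Metric.isClosed_closedBall.measurableSet
  have hmono : Monotone u := by
    intro M N hMN y
    have hMN' : (M : ℝ) ≤ N := by exact_mod_cast hMN
    refine (indicator_le_indicator_of_subset (Metric.closedBall_subset_closedBall hMN')
      (fun _ => zero_le) y).trans (indicator_le_indicator ?_)
    gcongr
  have hle : ∀ N y, u N y ≤ g y := fun N y =>
    (indicator_le_self _ _ y).trans (min_le_left _ _)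
  have hsup : ∀ y, ⨆ N, u N y = g y := fun y => by
    refine le_antisymm (iSup_le fun N => hle N y) (le_of_forall_lt fun c hc => ?_)
    obtain ⟨M, hM⟩ := ENNReal.exists_nat_gt hc.ne_top
    obtain ⟨L, hL⟩ := exists_nat_ge ‖y‖
    refine lt_of_lt_of_le ?_ (le_iSup _ (max M L))
    have hy : y ∈ B (max M L) := by
      simp only [hB, mem_closedBall_zero_iff]
      exact hL.trans (by exact_mod_cast le_max_right M L)
    simp only [hu, indicator_of_mem hy]
    refine lt_min hc (hM.trans_le ?_)
    exact_mod_cast le_max_left M L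
  rw [← lintegral_congr hsup, lintegral_iSup hum hmono, ENNReal.mul_iSup]
  refine iSup_le fun N => ?_
  have hutop : ∀ y, u N y ≠ ⊤ := fun y => by
    refine ((indicator_le_self _ _ y).trans_lt ?_).ne
    exact (min_le_right _ _).trans_lt (by simp)
  set v : (Fin (n + 1) → ℝ) → ℝ := fun y => (u N y).toReal with hv
  have hvm : Measurable v := (hum N).ennreal_toReal
  have hvN : ∀ y, ‖v y‖ ≤ (B N).indicator (fun _ => (N : ℝ)) y := fun y => by
    by_cases hy : y ∈ B N
    · simp only [hv, hu, indicator_of_mem hy, Real.norm_eq_abs, abs_of_nonneg ENNReal.toReal_nonneg]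
      exact (ENNReal.toReal_mono (by simp) (min_le_right (g y) N)).trans_eq (by simp)
    · simp [hv, hu, indicator_of_notMem hy]
  have hBi : Integrable ((B N).indicator fun _ => (N : ℝ)) :=
    (integrable_indicator_iff Metric.isClosed_closedBall.measurableSet).2
      (integrableOn_const (isCompact_closedBall _ _).measure_lt_top.ne)
  have hvi : Integrable v := hBi.mono' hvm.aestronglyMeasurable (.of_forall hvN)
  have hvi1 : Integrable fun y => v y • y := by
    refine (hBi.mul_const N).mono' (by fun_prop) (.of_forall fun y => ?_)
    rw [norm_smul]
    by_cases hy : y ∈ B N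
    · exact mul_le_mul (hvN y) (by simpa [hB] using hy) (norm_nonneg _) ((norm_nonneg _).trans (hvN y))
    · have := hvN y
      rw [indicator_of_notMem hy] at this ⊢
      simp [le_antisymm this (norm_nonneg _)]
  obtain ⟨z, hz⟩ := hC.exists_center hvm (fun y => ENNReal.toReal_nonneg) hvi hvi1
  have hdot : Measurable fun x : Fin (n + 1) → ℝ => x ⬝ᵥ z := by
    simp only [dotProduct]; fun_prop
  have key := hz (fun x => ENNReal.ofReal (f x * Real.exp (x ⬝ᵥ z))) (by fun_prop) fun y x => by
    calc ENNReal.ofReal (v (z + y)) * ENNReal.ofReal (f x * Real.exp (x ⬝ᵥ z))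
        ≤ g (z + y) * (ENNReal.ofReal (f x) * ENNReal.ofReal (Real.exp (x ⬝ᵥ z))) := by
          rw [ENNReal.ofReal_mul (hf0 x), ENNReal.ofReal_toReal (hutop _)]
          gcongr
          exact hle _ _
      _ = ENNReal.ofReal (f x) * g (z + y) * ENNReal.ofReal (Real.exp (x ⬝ᵥ z)) := by ring
      _ ≤ ENNReal.ofReal (Real.exp (-(x ⬝ᵥ (z + y)))) * ENNReal.ofReal (Real.exp (x ⬝ᵥ z)) := by
          gcongr
          exact h _ _
      _ = _ := by
          rw [← ENNReal.ofReal_mul (by positivity), ← Real.exp_add, dotProduct_add,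
            dotProduct_comm y x]
          congr 2
          ring
  have hvint : ENNReal.ofReal (∫ y, v y) = ∫⁻ y, u N y := by
    rw [ofReal_integral_eq_lintegral_ofReal hvi (.of_forall fun y => ENNReal.toReal_nonneg)]
    exact lintegral_congr fun y => ENNReal.ofReal_toReal (hutop y)
  have hi2 : Integrable fun x => (f x • x) ⬝ᵥ z := by
    simp only [dotProduct]
    exact integrable_finsetSum _ fun i _ => (hi1.eval i).mul_const _
  have hbar' : ∫ x, (f x • x) ⬝ᵥ z = 0 := by
    simp only [dotProduct]
    rw [integral_finsetSum _ fun i _ => (hi1.eval i).mul_const _]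
    refine Finset.sum_eq_zero fun i _ => ?_
    rw [integral_mul_const, ← eval_integral fun i => hi1.eval i, hbar]
    simp
  have hfexp : ENNReal.ofReal (∫ x, f x) ≤ ∫⁻ x, ENNReal.ofReal (f x * Real.exp (x ⬝ᵥ z)) := by
    have : ∫ x, f x = ∫ x, (f x + (f x • x) ⬝ᵥ z) := by
      rw [integral_add hi hi2, hbar', add_zero]
    have hu := (hi.add hi2).pos_part
    calc ENNReal.ofReal (∫ x, f x) ≤ ENNReal.ofReal (∫ x, max (f x + (f x • x) ⬝ᵥ z) 0) := by
          rw [this]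
          exact ENNReal.ofReal_le_ofReal
            (integral_mono (hi.add hi2) hu fun x => le_max_left _ _)
      _ = ∫⁻ x, ENNReal.ofReal (max (f x + (f x • x) ⬝ᵥ z) 0) :=
          ofReal_integral_eq_lintegral_ofReal hu (.of_forall fun x => le_max_right _ _)
      _ ≤ _ := by
          refine lintegral_mono fun x => ENNReal.ofReal_le_ofReal
            (max_le ?_ (mul_nonneg (hf0 x) (Real.exp_nonneg _)))
          rw [smul_dotProduct, smul_eq_mul]
          nlinarith [Real.add_one_le_exp (x ⬝ᵥ z), hf0 x]
  calc _ ≤ (∫⁻ x, ENNReal.ofReal (f x * Real.exp (x ⬝ᵥ z))) * ∫⁻ y, u N y := by gcongr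
    _ ≤ _ := by rwa [mul_comm, ← hvint]

/-- Lehec's functional Santaló inequality. -/
theorem centeredSantalo (n : ℕ) : CenteredSantalo n :=
  Nat.rec centeredSantalo_zero (fun _ h => h.succ) n

/-- The centered functional Santaló inequality on Euclidean space. -/
theorem santalo_euclideanSpace {n : ℕ} {f : EuclideanSpace ℝ (Fin n) → ℝ}
    {g : EuclideanSpace ℝ (Fin n) → ℝ≥0∞} (hf : Measurable f) (hf0 : ∀ x, 0 ≤ f x)
    (hi : Integrable f) (hi1 : Integrable fun x => f x • x) (hbar : ∫ x, f x • x = 0)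
    (hg : Measurable g)
    (h : ∀ x y, ENNReal.ofReal (f x) * g y ≤ ENNReal.ofReal (Real.exp (-⟪x, y⟫))) :
    ENNReal.ofReal (∫ x, f x) * ∫⁻ y, g y ≤ ENNReal.ofReal (2 * Real.pi) ^ n := by
  have hT := PiLp.volume_preserving_toLp (Fin n)
  let L := (PiLp.continuousLinearEquiv 2 ℝ fun _ : Fin n => ℝ).toContinuousLinearMap
  have hL : Integrable fun x => L (f x • x) := L.integrable_comp hi1
  have hcomp : (fun x : Fin n → ℝ => f (WithLp.toLp 2 x) • x)
      = (fun x => L (f x • x)) ∘ WithLp.toLp 2 := rfl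
  rw [← hT.integral_comp_of_integrable hi, ← hT.lintegral_comp hg]
  refine centeredSantalo n _ _ (hf.comp hT.measurable) (fun x => hf0 _)
    (hT.integrable_comp_of_integrable hi) ?_ ?_ (hg.comp hT.measurable) fun x y => ?_
  · rw [hcomp]
    exact hT.integrable_comp_of_integrable hL
  · rw [hcomp]
    refine (hT.integral_comp_of_integrable hL).trans ?_
    rw [L.integral_comp_comm hi1, hbar, map_zero]
  · refine (h _ _).trans_eq ?_
    simp [EuclideanSpace.inner_eq_star_dotProduct, dotProduct_comm]

/-- The Rayleigh distribution, with density `t * exp (-t ^ 2 / 2)` on the positive half-line. -/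
noncomputable def rayleigh : Measure ℝ :=
  (volume.restrict (Ioi 0)).withDensity fun t => ENNReal.ofReal (t * Real.exp (-(1 / 2) * t ^ 2))

theorem rayleigh_Ioi {a : ℝ} (ha : 0 ≤ a) :
    rayleigh (Ioi a) = ENNReal.ofReal (Real.exp (-(1 / 2) * a ^ 2)) := by
  have hd : ∀ t ∈ Ici a, HasDerivAt (fun t => -Real.exp (-(1 / 2) * t ^ 2))
      (t * Real.exp (-(1 / 2) * t ^ 2)) t := fun t _ => by
    refine (((hasDerivAt_pow 2 t).const_mul (-(1 / 2))).exp).fun_neg.congr_deriv ?_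
    push_cast
    ring
  have h0 : ∀ t ∈ Ioi a, 0 ≤ t * Real.exp (-(1 / 2) * t ^ 2) := fun t ht =>
    mul_nonneg (ha.trans (mem_Ioi.1 ht).le) (Real.exp_nonneg _)
  have hlim : Filter.Tendsto (fun t : ℝ => -Real.exp (-(1 / 2) * t ^ 2)) Filter.atTop
      (nhds (-0)) := by
    refine (Real.tendsto_exp_atBot.comp ?_).neg
    exact (Filter.tendsto_pow_atTop two_ne_zero).const_mul_atTop_of_neg (by norm_num)
  rw [rayleigh, withDensity_apply _ measurableSet_Ioi, Measure.restrict_restrict measurableSet_Ioi,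
    Ioi_inter_Ioi, sup_of_le_left ha, ← ofReal_integral_eq_lintegral_ofReal
      (integrableOn_Ioi_deriv_of_nonneg' hd h0 hlim) (ae_restrict_of_forall_mem measurableSet_Ioi h0),
    integral_Ioi_of_hasDerivAt_of_nonneg' hd h0 hlim]
  simp

theorem ae_rayleigh_pos : ∀ᵐ t ∂rayleigh, 0 < t :=
  (withDensity_absolutelyContinuous _ _).ae_le (ae_restrict_mem measurableSet_Ioi)

instance : NullSingletonClass rayleigh := ⟨fun x => withDensity_absolutelyContinuous _ _ (by simp)⟩

instance : IsProbabilityMeasure rayleigh := ⟨by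
  rw [← measure_congr (Filter.eventuallyEq_univ.2 ae_rayleigh_pos)]
  exact (rayleigh_Ioi le_rfl).trans (by simp)⟩

theorem rayleigh_le {A : Set ℝ} {a : ℝ} (ha : 0 ≤ a) (hA : ∀ t ∈ A, 0 < t → a ≤ t) :
    rayleigh A ≤ ENNReal.ofReal (Real.exp (-(1 / 2) * a ^ 2)) := by
  rw [← rayleigh_Ioi ha, measure_congr Ioi_ae_eq_Ici]
  refine measure_mono_ae ?_
  filter_upwards [ae_rayleigh_pos] with t ht htA
  exact hA t htA ht

theorem rayleigh_mul_rayleigh_le {A B : Set ℝ} {α : ℝ}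
    (h : ∀ s ∈ A, ∀ t ∈ B, 0 < s → 0 < t → α ≤ s * t) :
    rayleigh A * rayleigh B ≤ ENNReal.ofReal (Real.exp (-α)) := by
  have hnull : ∀ C : Set ℝ, C ∩ Ioi 0 = ∅ → rayleigh C = 0 := fun C hC => by
    refine measure_mono_null_ae (t := ∅) ?_ measure_empty
    filter_upwards [ae_rayleigh_pos] with t ht htC
    exact hC.subset ⟨htC, ht⟩
  rcases (A ∩ Ioi 0).eq_empty_or_nonempty with hA | hA
  · simp [hnull A hA]
  rcases (B ∩ Ioi 0).eq_empty_or_nonempty with hB | hB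
  · simp [hnull B hB]
  have hpos : ∀ C : Set ℝ, ∀ t ∈ C ∩ Ioi 0, 0 ≤ t := fun C t ht => (mem_Ioi.1 ht.2).le
  have ha := Real.sInf_nonneg (hpos A)
  have hb := Real.sInf_nonneg (hpos B)
  have hle : ∀ C : Set ℝ, ∀ t ∈ C, 0 < t → sInf (C ∩ Ioi 0) ≤ t := fun C t htC ht =>
    csInf_le ⟨0, hpos C⟩ ⟨htC, ht⟩
  have hα : α ≤ sInf (A ∩ Ioi 0) * sInf (B ∩ Ioi 0) := by
    rw [mul_comm, ← smul_eq_mul, ← Real.sInf_smul_of_nonneg hb]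
    refine le_csInf hA.smul_set ?_
    rintro _ ⟨s, hs, rfl⟩
    simp only [smul_eq_mul]
    rw [mul_comm, ← smul_eq_mul, ← Real.sInf_smul_of_nonneg (hpos A s hs)]
    refine le_csInf hB.smul_set ?_
    rintro _ ⟨t, ht, rfl⟩
    exact h s hs.1 t ht.1 hs.2 ht.2
  refine (mul_le_mul' (rayleigh_le ha (hle A)) (rayleigh_le hb (hle B))).trans ?_
  rw [← ENNReal.ofReal_mul (by positivity), ← Real.exp_add]
  gcongr
  nlinarith [sq_nonneg (sInf (A ∩ Ioi 0) - sInf (B ∩ Ioi 0))]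

section

variable {n : ℕ}

theorem measurableSet_cone {A : Set (EuclideanSpace ℝ (Fin n))} (hA : MeasurableSet A) :
    MeasurableSet {p : EuclideanSpace ℝ (Fin n) × ℝ | p.2⁻¹ • p.1 ∈ A} :=
  (measurable_snd.inv.smul measurable_fst) hA

theorem measurable_rayleigh_cone {A : Set (EuclideanSpace ℝ (Fin n))} (hA : MeasurableSet A) :
    Measurable fun x => rayleigh {t | t⁻¹ • x ∈ A} :=
  measurable_measure_prodMk_left (measurableSet_cone hA)

theorem lintegral_rayleigh_cone {A : Set (EuclideanSpace ℝ (Fin n))} (hA : MeasurableSet A) :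
    ∫⁻ x, rayleigh {t | t⁻¹ • x ∈ A}
      = (∫⁻ t, ENNReal.ofReal (t ^ n) ∂rayleigh) * volume A := by
  rw [← lintegral_mul_const _ (by fun_prop)]
  refine (Measure.prod_apply (measurableSet_cone hA)).symm.trans
    ((Measure.prod_apply_symm (measurableSet_cone hA)).trans (lintegral_congr_ae ?_))
  filter_upwards [ae_rayleigh_pos] with t ht
  refine (Measure.addHaar_preimage_smul volume (inv_ne_zero ht.ne') A).trans ?_
  simp [abs_of_pos ht]

theorem lintegral_rayleigh_cone_ball :
    ((∫⁻ t, ENNReal.ofReal (t ^ n) ∂rayleigh)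
      * volume (Metric.ball (0 : EuclideanSpace ℝ (Fin n)) 1)) ^ 2
      = ENNReal.ofReal (2 * Real.pi) ^ n := by
  have hball : ∀ x : EuclideanSpace ℝ (Fin n), rayleigh {t | t⁻¹ • x ∈ Metric.ball 0 1}
      = ENNReal.ofReal (Real.exp (-(1 / 2) * ‖x‖ ^ 2)) := fun x => by
    rw [← rayleigh_Ioi (norm_nonneg x)]
    refine measure_congr ?_
    filter_upwards [ae_rayleigh_pos] with t ht
    refine propext ?_
    change t⁻¹ • x ∈ Metric.ball 0 1 ↔ ‖x‖ < t
    rw [mem_ball_zero_iff, norm_smul, norm_inv, Real.norm_of_nonneg ht.le, inv_mul_lt_one₀ ht]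
  have hgauss := GaussianFourier.integral_rexp_neg_mul_sq_norm
    (V := EuclideanSpace ℝ (Fin n)) (b := 1 / 2) (by norm_num)
  have hInt : Integrable fun x : EuclideanSpace ℝ (Fin n) => Real.exp (-(1 / 2) * ‖x‖ ^ 2) := by
    refine .of_integral_ne_zero ?_
    rw [hgauss]
    positivity
  rw [← lintegral_rayleigh_cone measurableSet_ball, lintegral_congr hball,
    ← ofReal_integral_eq_lintegral_ofReal hInt (.of_forall fun x => by positivity), hgauss,
    ← ENNReal.ofReal_pow (by positivity), ← ENNReal.ofReal_pow (by positivity),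
    ← Real.rpow_mul_natCast (by positivity), finrank_euclideanSpace_fin, ← Real.rpow_natCast]
  congr 2
  · ring
  · push_cast; ring

theorem integrable_rayleigh_cone_mul_norm {K : Set (EuclideanSpace ℝ (Fin n))}
    (hK : IsCompact K) : Integrable fun x => rayleigh.real {t | t⁻¹ • x ∈ K} * ‖x‖ := by
  obtain ⟨R, hR, hKR⟩ := hK.isBounded.exists_pos_norm_le
  set b : ℝ := 1 / (2 * R) with hb
  have hb0 : 0 < b := by positivity
  have hInt : Integrable fun x : EuclideanSpace ℝ (Fin n) => b⁻¹ * Real.exp (-b ^ 2 * ‖x‖ ^ 2) := by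
    refine .const_mul (.of_integral_ne_zero ?_) _
    rw [GaussianFourier.integral_rexp_neg_mul_sq_norm (by positivity)]
    positivity
  refine hInt.mono' ?_ (.of_forall fun x => ?_)
  · exact ((measurable_rayleigh_cone hK.measurableSet).ennreal_toReal.mul
      measurable_norm).aestronglyMeasurable
  have h1 : rayleigh.real {t | t⁻¹ • x ∈ K} ≤ Real.exp (-(1 / 2) * (‖x‖ / R) ^ 2) := by
    refine ENNReal.toReal_le_of_le_ofReal (by positivity)
      (rayleigh_le (by positivity) fun t ht ht0 => ?_)
    have := hKR _ ht
    rw [norm_smul, norm_inv, Real.norm_of_nonneg ht0.le, inv_mul_le_iff₀ ht0] at this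
    exact (div_le_iff₀ hR).2 this
  have h2 : b * ‖x‖ ≤ Real.exp (b ^ 2 * ‖x‖ ^ 2) := by
    nlinarith [Real.add_one_le_exp (b ^ 2 * ‖x‖ ^ 2), sq_nonneg (b * ‖x‖ - 1)]
  rw [Real.norm_of_nonneg (by positivity)]
  calc _ ≤ Real.exp (-(1 / 2) * (‖x‖ / R) ^ 2) * (b⁻¹ * Real.exp (b ^ 2 * ‖x‖ ^ 2)) := by
        gcongr
        rwa [← div_eq_inv_mul, le_div_iff₀ hb0, mul_comm]
    _ = _ := by
        rw [mul_left_comm, ← Real.exp_add]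
        congr 2
        rw [hb]
        field_simp
        ring

theorem integral_rayleigh_cone_smul {K : Set (EuclideanSpace ℝ (Fin n))} (hK : IsCompact K)
    (hbar : ∫ x in K, x = 0) : ∫ x, rayleigh.real {t | t⁻¹ • x ∈ K} • x = 0 := by
  let S : Set (EuclideanSpace ℝ (Fin n) × ℝ) := {p | p.2⁻¹ • p.1 ∈ K}
  have hS : MeasurableSet S := measurableSet_cone hK.measurableSet
  have hsec : ∀ x, MeasurableSet {t : ℝ | t⁻¹ • x ∈ K} := fun x => measurable_prodMk_left hS
  have hind : ∀ x t, S.indicator Prod.fst (x, t) = {t : ℝ | t⁻¹ • x ∈ K}.indicator (fun _ => x) t :=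
    fun x t => rfl
  have hInt : Integrable (S.indicator Prod.fst) (volume.prod rayleigh) := by
    refine (integrable_prod_iff (measurable_fst.indicator hS).aestronglyMeasurable).2 ⟨?_, ?_⟩
    · refine .of_forall fun x => ?_
      simp only [hind]
      exact (integrable_const x).indicator (hsec x)
    · refine (integrable_rayleigh_cone_mul_norm hK).congr (.of_forall fun x => ?_)
      simp only [hind, norm_indicator_eq_indicator_norm]
      rw [integral_indicator_const _ (hsec x), smul_eq_mul]
  calc _ = ∫ x, (∫ t, S.indicator Prod.fst (x, t) ∂rayleigh) := by
        refine integral_congr_ae (.of_forall fun x => ?_)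
        simp only [hind]
        rw [integral_indicator_const _ (hsec x)]
    _ = ∫ t, (∫ x, S.indicator Prod.fst (x, t)) ∂rayleigh := integral_integral_swap hInt
    _ = 0 := by
        refine integral_eq_zero_of_ae ?_
        filter_upwards [ae_rayleigh_pos] with t ht
        have : ∀ x, S.indicator Prod.fst (x, t)
            = (fun y => K.indicator (fun y => t • y) y) (t⁻¹ • x) := fun x => by
          simp [S, indicator, smul_smul, ht.ne']
        simp only [this]
        rw [Measure.integral_comp_inv_smul, integral_indicator hK.measurableSet, integral_smul,
          hbar, smul_zero, smul_zero, Pi.zero_apply]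

theorem isClosed_polarSet (K : Set (EuclideanSpace ℝ (Fin n))) : IsClosed (polarSet K) := by
  simp only [polarSet, ofPred_forall]
  exact isClosed_biInter fun x _ => isClosed_le (by fun_prop) continuous_const

end

/-- Blaschke-Santaló inequality for compact sets with barycenter at the origin:
if `K` is compact with `|K| > 0`, `0 ∈ int(conv K)` and `∫_K x dx = 0`
(i.e. `bar(K) = 0`), then `|K|·|K°| ≤ |B₂ⁿ|²`. -/
theorem blaschke_santalo_compact_centered (n : ℕ) (K : Set (EuclideanSpace ℝ (Fin n)))
    (hKcomp : IsCompact K) (hKvol : 0 < volume K)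
    (h0 : (0 : EuclideanSpace ℝ (Fin n)) ∈ interior (convexHull ℝ K))
    (hbar : ∫ x in K, x ∂volume = (0 : EuclideanSpace ℝ (Fin n))) :
    volume K * volume (polarSet K)
      ≤ (volume (Metric.ball (0 : EuclideanSpace ℝ (Fin n)) 1)) ^ 2 := by
  have hball := lintegral_rayleigh_cone_ball (n := n)
  have hK := lintegral_rayleigh_cone hKcomp.measurableSet
  have hP := lintegral_rayleigh_cone (isClosed_polarSet K).measurableSet
  set c := ∫⁻ t, ENNReal.ofReal (t ^ n) ∂rayleigh with hc
  have hB0 : volume (Metric.ball (0 : EuclideanSpace ℝ (Fin n)) 1) ≠ 0 :=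
    (Metric.measure_ball_pos volume 0 one_pos).ne'
  have hc0 : c ≠ 0 := by
    rintro h
    rw [h, zero_mul, zero_pow two_ne_zero, eq_comm] at hball
    exact pow_ne_zero n (ENNReal.ofReal_pos.2 (by positivity)).ne' hball
  have hct : c ≠ ⊤ := by
    rintro h
    rw [h, ENNReal.top_mul hB0, ENNReal.top_pow two_ne_zero, eq_comm] at hball
    exact ENNReal.pow_ne_top ENNReal.ofReal_ne_top hball
  have hfm := (measurable_rayleigh_cone hKcomp.measurableSet).ennreal_toReal
  have hfi : Integrable fun x => rayleigh.real {t | t⁻¹ • x ∈ K} := by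
    refine integrable_toReal_of_lintegral_ne_top
      (measurable_rayleigh_cone hKcomp.measurableSet).aemeasurable ?_
    rw [hK]
    exact ENNReal.mul_ne_top hct hKcomp.measure_lt_top.ne
  have hfi1 : Integrable fun x => rayleigh.real {t | t⁻¹ • x ∈ K} • x := by
    refine (integrable_rayleigh_cone_mul_norm hKcomp).mono'
      (hfm.smul measurable_id).aestronglyMeasurable (.of_forall fun x => ?_)
    rw [norm_smul, Real.norm_of_nonneg measureReal_nonneg]
  have key := santalo_euclideanSpace hfm (fun _ => ENNReal.toReal_nonneg) hfi hfi1
    (integral_rayleigh_cone_smul hKcomp hbar)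
    (measurable_rayleigh_cone (isClosed_polarSet K).measurableSet) fun x y => by
      rw [ENNReal.ofReal_toReal (measure_ne_top _ _)]
      refine rayleigh_mul_rayleigh_le fun s hs t ht hs0 ht0 => ?_
      have := ht _ hs
      rw [inner_smul_left, inner_smul_right, conj_trivial, ← mul_assoc, ← mul_inv,
        inv_mul_le_iff₀ (by positivity), mul_one] at this
      exact this
  simp only [measureReal_def] at hfi
  rw [ofReal_integral_eq_lintegral_ofReal hfi (.of_forall fun _ => ENNReal.toReal_nonneg)] at key
  simp only [ENNReal.ofReal_toReal (measure_ne_top rayleigh _)] at key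
  rw [hK, hP, ← hball, mul_mul_mul_comm, mul_pow, ← sq] at key
  exact (ENNReal.mul_le_mul_iff_right (pow_ne_zero 2 hc0) (ENNReal.pow_ne_top hct)).1 key
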